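/- The class of all finite linearly ordered 3-hypertournaments has the Ramsey property: for all finite linearly ordered 3-hypertournaments A and B there exists a finite linearly ordered 3-hypertournament C such that for every 2-colouring of the embeddings of A into C, there is an embedding of B into C all of whose induced embeddings of A have the same colour. -/

import Mathlib

def IsHyper3 {T : Type*} (R : T → T → T → Prop) : Prop :=
  (∀ a b c, R a b c → a ≠ b ∧ b ≠ c ∧ a ≠ c) ∧
  (∀ a b c, R a b c → R b c a) ∧
  (∀ a b c, a ≠ b → b ≠ c → a ≠ c → (R a b c ↔ ¬ R a c b))

/-- A finite linearly ordered 3-hypertournament (carrier Fin n with its order). -/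
structure OrdHT where
  n : ℕ
  R : Fin n → Fin n → Fin n → Prop
  hyper : IsHyper3 R

/-- An embedding of ordered 3-hypertournaments: order-preserving and preserving R in
both directions. -/
structure OrdHT.Emb (A B : OrdHT) where
  f : Fin A.n → Fin B.n
  mono : StrictMono f
  pres : ∀ x y z, A.R x y z ↔ B.R (f x) (f y) (f z)

def OrdHT.Emb.comp {A B C : OrdHT} (g : B.Emb C) (e : A.Emb B) : A.Emb C :=
  ⟨g.f ∘ e.f, g.mono.comp e.mono, fun x y z => (e.pres x y z).trans (g.pres _ _ _)⟩

/-! ### Finite Ramsey theorem -/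

theorem ramsey_finset (a : ℕ) : ∀ b : ℕ, ∃ p : ℕ, ∀ S : Finset ℕ, p ≤ S.card →
    ∀ c : Finset ℕ → Fin 2, ∃ T ⊆ S, T.card = b ∧ ∃ col : Fin 2, ∀ X ⊆ T, X.card = a → c X = col := by
  induction a with
  | zero =>
    intro b
    refine ⟨b, fun S hS c => ?_⟩
    obtain ⟨T, hT, hc⟩ := Finset.exists_subset_card_eq hS
    refine ⟨T, hT, hc, c ∅, fun X _ h => ?_⟩
    rw [Finset.card_eq_zero.mp h]
  | succ a ih =>
    have claim : ∀ m : ℕ, ∃ p : ℕ, ∀ S : Finset ℕ, p ≤ S.card → ∀ c : Finset ℕ → Fin 2,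
        ∃ H ⊆ S, H.card = m ∧ ∃ d : ℕ → Fin 2, ∀ X ⊆ H, X.card = a + 1 →
          ∃ x ∈ X, c X = d x := by
      intro m
      induction m with
      | zero =>
        refine ⟨0, fun S _ c => ⟨∅, by simp, by simp, fun _ => 0, fun X hX h => ?_⟩⟩
        rw [Finset.subset_empty.mp hX] at h
        simp at h
      | succ m ihm =>
        obtain ⟨q, hq⟩ := ihm
        obtain ⟨N, hN⟩ := ih q
        refine ⟨N + 1, fun S hS c => ?_⟩
        have hne : S.Nonempty := by
          rw [← Finset.card_pos]; omega
        obtain ⟨x, hx⟩ := hne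
        have hS' : N ≤ (S.erase x).card := by
          rw [Finset.card_erase_of_mem hx]; omega
        obtain ⟨T, hTS, hTc, col, hcol⟩ := hN (S.erase x) hS' (fun X => c (insert x X))
        obtain ⟨H, hHT, hHc, d, hd⟩ := hq T hTc.ge c
        have hxT : x ∉ T := fun h => by simpa using hTS h
        have hxH : x ∉ H := fun h => hxT (hHT h)
        refine ⟨insert x H, ?_, ?_, Function.update d x col, fun X hX hXc => ?_⟩
        · intro y hy
          rcases Finset.mem_insert.mp hy with rfl | hy
          · exact hx
          · exact Finset.mem_of_mem_erase (hTS (hHT hy))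
        · rw [Finset.card_insert_of_notMem hxH, hHc]
        · by_cases hxX : x ∈ X
          · refine ⟨x, hxX, ?_⟩
            have h1 := hcol (X.erase x) (fun y hy => by
              have h2 := hX (Finset.mem_of_mem_erase hy)
              have h3 := Finset.ne_of_mem_erase hy
              exact hHT ((Finset.mem_insert.mp h2).resolve_left h3))
              (by rw [Finset.card_erase_of_mem hxX]; omega)
            simp only [Finset.insert_erase hxX] at h1
            simp [h1]
          · obtain ⟨y, hy, hyc⟩ := hd X (fun y hy => by
              refine (Finset.mem_insert.mp (hX hy)).resolve_left ?_
              rintro rfl; exact hxX hy) hXc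
            refine ⟨y, hy, ?_⟩
            rw [Function.update_of_ne, hyc]
            rintro rfl; exact hxX hy
    intro b
    obtain ⟨p, hp⟩ := claim (2 * b)
    refine ⟨p, fun S hS c => ?_⟩
    obtain ⟨H, hHS, hHc, d, hd⟩ := hp S hS c
    have key : ∃ col : Fin 2, b ≤ (H.filter (fun x => d x = col)).card := by
      by_contra! hcon
      have h0 := hcon 0
      have h1 := hcon 1
      have h2 := Finset.card_filter_add_card_filter_not (s := H) (fun x => d x = 0)
      have h3 : H.filter (fun x => ¬ d x = 0) = H.filter (fun x => d x = 1) := by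
        apply Finset.filter_congr
        intro x _
        generalize d x = e
        fin_cases e <;> simp
      rw [h3] at h2
      omega
    obtain ⟨col, hcol⟩ := key
    obtain ⟨T, hT, hTc⟩ := Finset.exists_subset_card_eq hcol
    refine ⟨T, fun x hx => hHS (Finset.mem_filter.mp (hT hx)).1, hTc, col, fun X hX hXc => ?_⟩
    obtain ⟨x, hx, hxc⟩ := hd X (fun y hy => (Finset.mem_filter.mp (hT (hX hy))).1) hXc
    rw [hxc]
    exact (Finset.mem_filter.mp (hT (hX hx))).2

theorem ramsey_fin (a b : ℕ) : ∃ p : ℕ, ∀ c : (Fin a → Fin p) → Fin 2,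
    ∃ g : Fin b ↪o Fin p, ∃ col : Fin 2, ∀ e : Fin a → Fin b, StrictMono e → c (g ∘ e) = col := by
  obtain ⟨p, hp⟩ := ramsey_finset a b
  refine ⟨p, fun c => ?_⟩
  classical
  obtain ⟨T, hTS, hTc, col, hcol⟩ := hp (Finset.range p) (by simp) (fun X =>
    if h : ∃ e : Fin a → Fin p, StrictMono e ∧ Finset.univ.image (fun i => (e i : ℕ)) = X
    then c h.choose else 0)
  have hlt : ∀ i, (T.orderEmbOfFin hTc i) < p := fun i =>
    Finset.mem_range.mp (hTS (Finset.orderEmbOfFin_mem T hTc i))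
  let g : Fin b ↪o Fin p := OrderEmbedding.ofStrictMono (fun i => ⟨T.orderEmbOfFin hTc i, hlt i⟩)
    (fun i j hij => by
      show T.orderEmbOfFin hTc i < T.orderEmbOfFin hTc j
      simpa using hij)
  refine ⟨g, col, fun e he => ?_⟩
  have hge : StrictMono (g ∘ e) := g.strictMono.comp he
  set X : Finset ℕ := Finset.univ.image (fun i => ((g ∘ e) i : ℕ)) with hX
  have hXT : X ⊆ T := by
    intro y hy
    obtain ⟨i, -, rfl⟩ := Finset.mem_image.mp hy
    exact Finset.orderEmbOfFin_mem T hTc (e i)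
  have hXc : X.card = a := by
    rw [hX, Finset.card_image_of_injective]
    · simp
    · exact Fin.val_injective.comp hge.injective
  have h1 := hcol X hXT hXc
  have hex : ∃ e' : Fin a → Fin p, StrictMono e' ∧
      Finset.univ.image (fun i => (e' i : ℕ)) = X := ⟨g ∘ e, hge, rfl⟩
  rw [dif_pos hex] at h1
  have h2 : hex.choose = g ∘ e := by
    have h3 := hex.choose_spec
    apply (StrictMono.range_inj h3.1 hge).mp
    ext y
    have h4 := congrArg (fun Z : Finset ℕ => (y : ℕ) ∈ Z) (h3.2.trans hX)
    simpa [Fin.val_inj] using h4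
  rw [← h2]; exact h1

/-! ### Partite systems -/

/-- `Sys p V`: a `p`-partite 3-uniform hypergraph each of whose parts is a copy of `V`. -/
abbrev Sys (p : ℕ) (V : Type) := Fin p → Fin p → Fin p → V → V → V → Prop

/-- Part preserving maps, strong on transversal triples. -/
def Sys.Hom {p : ℕ} {V W : Type} (E : Sys p V) (F : Sys p W) (f : Fin p → V → W) : Prop :=
  ∀ i j k, i < j → j < k → ∀ x y z, E i j k x y z ↔ F i j k (f i x) (f j y) (f k z)

/-- `s` is a transversal copy of `A` over the parts `α`. -/
def Sys.Copy {p a : ℕ} {V : Type} (E : Sys p V) (A : Fin a → Fin a → Fin a → Prop)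
    (α : Fin a → Fin p) (s : Fin a → V) : Prop :=
  ∀ u v w, u < v → v < w → (A u v w ↔ E (α u) (α v) (α w) (s u) (s v) (s w))

theorem Sys.Copy.map {p a : ℕ} {V W : Type} {E : Sys p V} {F : Sys p W} {f : Fin p → V → W}
    (hf : E.Hom F f) {A : Fin a → Fin a → Fin a → Prop} {α : Fin a → Fin p} (hα : StrictMono α)
    {s : Fin a → V} (hs : E.Copy A α s) : F.Copy A α (fun u => f (α u) (s u)) := by
  intro u v w huv hvw
  rw [hs u v w huv hvw]
  exact hf _ _ _ (hα huv) (hα hvw) _ _ _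

/-- Lift of a system to `Option`. -/
def Sys.opt {p : ℕ} {V : Type} (E : Sys p V) (i j k : Fin p) (x y z : Option V) : Prop :=
  ∃ x' y' z', x = some x' ∧ y = some y' ∧ z = some z' ∧ E i j k x' y' z'

theorem partite_step {p a : ℕ} (A : Fin a → Fin a → Fin a → Prop) (α : Fin a → Fin p)
    (hα : StrictMono α) (V : Type) [Finite V] (E : Sys p V) :
    ∃ (W : Type) (_ : Finite W) (F : Sys p W), ∀ χ : (Fin a → W) → Fin 2,
      ∃ f, E.Hom F f ∧ ∃ col, ∀ s, E.Copy A α s → χ (fun u => f (α u) (s u)) = col := by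
  classical
  obtain ⟨ι, _, hι⟩ := Combinatorics.Line.exists_mono_in_high_dimension
    {s : Fin a → V // E.Copy A α s} (Fin 2)
  refine ⟨ι → Option V, inferInstance, fun i j k x y z =>
    if ∃ u v w, α u = i ∧ α v = j ∧ α w = k ∧ A u v w
    then ∀ t, E.opt i j k (x t) (y t) (z t) else ∃ t, E.opt i j k (x t) (y t) (z t), fun χ => ?_⟩
  obtain ⟨l, col, hl⟩ := hι (fun w => χ (fun u t => some ((w t).1 u)))
  obtain ⟨t₀, ht₀⟩ := l.proper
  let f : Fin p → V → ι → Option V := fun i x t =>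
    match l.idxFun t with
    | none => some x
    | some s => if h : ∃ u, α u = i then some (s.1 h.choose) else none
  have f_none : ∀ t, l.idxFun t = none → ∀ i x, f i x t = some x := by
    intro t ht i x
    simp only [f, ht]
  have f_some : ∀ t s, l.idxFun t = some s → ∀ u x, f (α u) x t = some (s.1 u) := by
    intro t s ht u x
    have h : ∃ u', α u' = α u := ⟨u, rfl⟩
    simp only [f, ht]
    rw [dif_pos h, hα.injective h.choose_spec]
  have f_out : ∀ t s, l.idxFun t = some s → ∀ i x y, f i x t = some y → ∃ u, α u = i := by
    intro t s ht i x y h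
    simp only [f, ht] at h
    by_contra hcon
    rw [dif_neg hcon] at h
    cases h
  refine ⟨f, ?_, col, ?_⟩
  · intro i j k hij hjk x y z
    have act : ∀ t, l.idxFun t = none →
        (E.opt i j k (f i x t) (f j y t) (f k z t) ↔ E i j k x y z) := by
      intro t ht
      rw [f_none t ht, f_none t ht, f_none t ht]
      constructor
      · rintro ⟨x', y', z', hx, hy, hz, h⟩
        cases hx; cases hy; cases hz; exact h
      · intro h; exact ⟨x, y, z, rfl, rfl, rfl, h⟩
    beta_reduce
    split_ifs with hA
    · constructor
      · intro h t
        rcases ht : l.idxFun t with _ | s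
        · exact (act t ht).mpr h
        · obtain ⟨u, v, w, rfl, rfl, rfl, hA⟩ := hA
          rw [f_some t s ht, f_some t s ht, f_some t s ht]
          exact ⟨_, _, _, rfl, rfl, rfl,
            (s.2 u v w (hα.lt_iff_lt.mp hij) (hα.lt_iff_lt.mp hjk)).mp hA⟩
      · intro h
        exact (act t₀ ht₀).mp (h t₀)
    · constructor
      · intro h
        exact ⟨t₀, (act t₀ ht₀).mpr h⟩
      · rintro ⟨t, h⟩
        rcases ht : l.idxFun t with _ | s
        · exact (act t ht).mp h
        · exfalso
          obtain ⟨x', y', z', hx, hy, hz, h⟩ := h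
          obtain ⟨u, rfl⟩ := f_out t s ht _ _ _ hx
          obtain ⟨v, rfl⟩ := f_out t s ht _ _ _ hy
          obtain ⟨w, rfl⟩ := f_out t s ht _ _ _ hz
          rw [f_some t s ht] at hx hy hz
          cases hx; cases hy; cases hz
          exact hA ⟨u, v, w, rfl, rfl, rfl,
            (s.2 u v w (hα.lt_iff_lt.mp hij) (hα.lt_iff_lt.mp hjk)).mpr h⟩
  · intro s hs
    rw [← hl ⟨s, hs⟩]
    congr 1
    funext u t
    rcases ht : l.idxFun t with _ | s'
    · rw [f_none t ht, Combinatorics.Line.apply_none _ _ _ ht]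
    · rw [f_some t s' ht, Combinatorics.Line.apply_some ht]

theorem partite_iter {p a : ℕ} (A : Fin a → Fin a → Fin a → Prop) (l : List (Fin a → Fin p)) :
    (∀ α ∈ l, StrictMono α) → ∀ (V : Type) [Finite V] (E : Sys p V),
    ∃ (W : Type) (_ : Finite W) (F : Sys p W), ∀ χ : (Fin a → Fin p) → (Fin a → W) → Fin 2,
      ∃ f, E.Hom F f ∧ ∀ α ∈ l, ∃ col, ∀ s, E.Copy A α s →
        χ α (fun u => f (α u) (s u)) = col := by
  induction l with
  | nil =>
    intro _ V _ E
    exact ⟨V, inferInstance, E, fun χ => ⟨fun _ x => x, fun i j k _ _ x y z => Iff.rfl, by simp⟩⟩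
  | cons α l ih =>
    intro hl V _ E
    have hα := hl α (by simp)
    obtain ⟨W₁, _, F₁, h₁⟩ := partite_step A α hα V E
    obtain ⟨W, hW, F, h⟩ := ih (fun β hβ => hl β (by simp [hβ])) W₁ F₁
    refine ⟨W, hW, F, fun χ => ?_⟩
    obtain ⟨f, hf, hfc⟩ := h χ
    obtain ⟨g, hg, col, hgc⟩ := h₁ (fun s => χ α (fun u => f (α u) (s u)))
    refine ⟨fun i x => f i (g i x), fun i j k hij hjk x y z =>
      (hg i j k hij hjk x y z).trans (hf i j k hij hjk _ _ _), fun β hβ => ?_⟩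
    rcases List.mem_cons.mp hβ with rfl | hβ'
    · exact ⟨col, hgc⟩
    · obtain ⟨col', hc⟩ := hfc β hβ'
      exact ⟨col', fun s hs => hc _ (Sys.Copy.map hg (hl β hβ) hs)⟩

/-! ### From ordered hypergraphs to hypertournaments -/

/-- The hypertournament on a linear order determined by a set of increasing triples. -/
def ofTriples {T : Type*} [LinearOrder T] (D : T → T → T → Prop) (x y z : T) : Prop :=
  (x < y ∧ y < z ∧ D x y z) ∨ (y < z ∧ z < x ∧ D y z x) ∨ (z < x ∧ x < y ∧ D z x y) ∨
  (x < z ∧ z < y ∧ ¬ D x z y) ∨ (z < y ∧ y < x ∧ ¬ D z y x) ∨ (y < x ∧ x < z ∧ ¬ D y x z)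

theorem ofTriples_of_lt {T : Type*} [LinearOrder T] (D : T → T → T → Prop) {x y z : T}
    (hxy : x < y) (hyz : y < z) : ofTriples D x y z ↔ D x y z := by
  have h1 := hxy.not_gt
  have h2 := hyz.not_gt
  have h3 := (hxy.trans hyz).not_gt
  simp [ofTriples, *]

theorem ofTriples_hyper {T : Type*} [LinearOrder T] (D : T → T → T → Prop) :
    IsHyper3 (ofTriples D) := by
  refine ⟨?_, ?_, ?_⟩
  · rintro a b c (h | h | h | h | h | h) <;> obtain ⟨h1, h2, -⟩ := h <;>
      have h3 := h1.trans h2 <;>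
      simp [h1.ne, h2.ne, h3.ne, h1.ne', h2.ne', h3.ne']
  · rintro a b c (h | h | h | h | h | h)
    · exact Or.inr (Or.inr (Or.inl h))
    · exact Or.inl h
    · exact Or.inr (Or.inl h)
    · exact Or.inr (Or.inr (Or.inr (Or.inr (Or.inl h))))
    · exact Or.inr (Or.inr (Or.inr (Or.inr (Or.inr h))))
    · exact Or.inr (Or.inr (Or.inr (Or.inl h)))
  · intro a b c hab hbc hac
    rcases lt_or_gt_of_ne hab with h1 | h1 <;> rcases lt_or_gt_of_ne hbc with h2 | h2 <;>
    rcases lt_or_gt_of_ne hac with h3 | h3 <;>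
    first
    | exact absurd (h1.trans h2) h3.not_gt
    | exact absurd (h2.trans h1) h3.not_gt
    | (have := h1.not_gt; have := h2.not_gt; have := h3.not_gt; simp [ofTriples, *])

theorem hyper_ext {S T : Type*} [LinearOrder S] [LinearOrder T] {R : S → S → S → Prop}
    {Q : T → T → T → Prop} (hR : IsHyper3 R) (hQ : IsHyper3 Q) {f : S → T} (hf : StrictMono f)
    (h : ∀ x y z, x < y → y < z → (R x y z ↔ Q (f x) (f y) (f z))) (x y z : S) :
    R x y z ↔ Q (f x) (f y) (f z) := by
  obtain ⟨r1, r2, r3⟩ := hR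
  obtain ⟨q1, q2, q3⟩ := hQ
  have inj := hf.injective
  have rot : ∀ x y z, (R x y z ↔ Q (f x) (f y) (f z)) → (R y z x ↔ Q (f y) (f z) (f x)) :=
    fun x y z hh => ⟨fun a => q2 _ _ _ (hh.mp (r2 _ _ _ (r2 _ _ _ a))),
      fun a => r2 _ _ _ (hh.mpr (q2 _ _ _ (q2 _ _ _ a)))⟩
  have sw : ∀ x y z, x ≠ y → y ≠ z → x ≠ z → (R x y z ↔ Q (f x) (f y) (f z)) →
      (R x z y ↔ Q (f x) (f z) (f y)) := fun x y z h1 h2 h3 hh => by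
    have e1 := r3 x y z h1 h2 h3
    have e2 := q3 (f x) (f y) (f z) (inj.ne h1) (inj.ne h2) (inj.ne h3)
    tauto
  by_cases hxy : x = y
  · exact ⟨fun a => absurd hxy (r1 _ _ _ a).1, fun a => absurd (congrArg f hxy) (q1 _ _ _ a).1⟩
  by_cases hyz : y = z
  · exact ⟨fun a => absurd hyz (r1 _ _ _ a).2.1,
      fun a => absurd (congrArg f hyz) (q1 _ _ _ a).2.1⟩
  by_cases hxz : x = z
  · exact ⟨fun a => absurd hxz (r1 _ _ _ a).2.2,
      fun a => absurd (congrArg f hxz) (q1 _ _ _ a).2.2⟩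
  rcases lt_or_gt_of_ne hxy with h1 | h1 <;> rcases lt_or_gt_of_ne hyz with h2 | h2 <;>
    rcases lt_or_gt_of_ne hxz with h3 | h3
  · exact h _ _ _ h1 h2
  · exact absurd (h1.trans h2) h3.not_gt
  · exact sw _ _ _ hxz (Ne.symm hyz) hxy (h _ _ _ h3 h2)
  · exact rot _ _ _ (h _ _ _ h3 h1)
  · exact rot _ _ _ (rot _ _ _ (sw _ _ _ (Ne.symm hxy) hxz hyz (h _ _ _ h1 h3)))
  · exact rot _ _ _ (rot _ _ _ (h _ _ _ h2 h3))
  · exact absurd (h2.trans h1) h3.not_gt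
  · exact rot _ _ _ (sw _ _ _ (Ne.symm hyz) (Ne.symm hxy) (Ne.symm hxz) (h _ _ _ h2 h1))

/-- the class of finite linearly ordered 3-hypertournaments has the
Ramsey property. -/
theorem stmt12 : ∀ A B : OrdHT, ∃ C : OrdHT,
    ∀ χ : A.Emb C → Fin 2, ∃ g : B.Emb C,
      ∀ e e' : A.Emb B, χ (g.comp e) = χ (g.comp e') := by
  classical
  intro A B
  obtain ⟨p, hp⟩ := ramsey_fin A.n B.n
  -- the initial picture: disjoint transversal copies of `B`
  let E₀ : Sys p (Fin B.n ↪o Fin p) := fun i j k x y z =>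
    ∃ u v w, y = x ∧ z = x ∧ x u = i ∧ x v = j ∧ x w = k ∧ B.R u v w
  obtain ⟨W, _, F, hF⟩ := partite_iter A.R
    (Finset.univ.filter (fun α : Fin A.n → Fin p => StrictMono α)).toList
    (by simp) (Fin B.n ↪o Fin p) E₀
  obtain ⟨m, ⟨eW⟩⟩ := Finite.exists_equiv_fin W
  let q : Fin p × W ≃ Fin (p * m) := (Equiv.prodCongr (Equiv.refl _) eW).trans finProdFinEquiv
  have hq : ∀ i j x y, i < j → q (i, x) < q (j, y) := by
    intro i j x y hij
    have h1 := (eW x).2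
    have h2 : (i : ℕ) + 1 ≤ j := hij
    have h3 : m * (i + 1) ≤ m * j := Nat.mul_le_mul_left m h2
    show (eW x : ℕ) + m * i < (eW y : ℕ) + m * j
    rw [Nat.mul_succ] at h3
    omega
  let D : Fin (p * m) → Fin (p * m) → Fin (p * m) → Prop := fun x y z =>
    F (q.symm x).1 (q.symm y).1 (q.symm z).1 (q.symm x).2 (q.symm y).2 (q.symm z).2
  let C : OrdHT := ⟨p * m, ofTriples D, ofTriples_hyper D⟩
  -- transversal copies give embeddings
  have mkEmb : ∀ (X : OrdHT) (α : Fin X.n → Fin p) (_ : StrictMono α) (s : Fin X.n → W)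
      (_ : F.Copy X.R α s), ∃ e : X.Emb C, e.f = fun u => q (α u, s u) := by
    intro X α hα s hs
    have hm : StrictMono (fun u => q (α u, s u)) := fun u v huv => hq _ _ _ _ (hα huv)
    refine ⟨⟨fun u => q (α u, s u), hm,
      hyper_ext X.hyper (ofTriples_hyper D) hm fun x y z hxy hyz => ?_⟩, rfl⟩
    rw [ofTriples_of_lt D (hm hxy) (hm hyz), hs x y z hxy hyz]
    simp [D]
  refine ⟨C, fun χ => ?_⟩
  obtain ⟨f, hf, hfc⟩ := hF (fun α s =>
    if h : ∃ e : A.Emb C, e.f = fun u => q (α u, s u) then χ h.choose else 0)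
  have hfc' : ∀ α : Fin A.n → Fin p, ∃ col, StrictMono α → ∀ s, E₀.Copy A.R α s →
      ∀ e : A.Emb C, (e.f = fun u => q (α u, f (α u) (s u))) → χ e = col := by
    intro α
    by_cases hα : StrictMono α
    · obtain ⟨col, hc⟩ := hfc α (by simpa using hα)
      refine ⟨col, fun _ s hs e he => ?_⟩
      have h1 := hc s hs
      have hex : ∃ e : A.Emb C, e.f = fun u => q (α u, f (α u) (s u)) := ⟨e, he⟩
      rw [dif_pos hex] at h1
      have h2 : hex.choose = e := by
        have h3 := hex.choose_spec.trans he.symm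
        generalize hex.choose = e' at h3
        cases e'; cases e; cases h3; rfl
      rw [← h2]; exact h1
    · exact ⟨0, fun h => absurd h hα⟩
  choose c hc using hfc'
  obtain ⟨β, col, hβ⟩ := hp c
  have hcopy : E₀.Copy B.R β (fun _ => β) := by
    intro u v w _ _
    constructor
    · intro h; exact ⟨u, v, w, rfl, rfl, rfl, rfl, rfl, h⟩
    · rintro ⟨u', v', w', -, -, h1, h2, h3, h⟩
      rw [← β.injective h1, ← β.injective h2, ← β.injective h3]; exact h
  obtain ⟨g, hg⟩ := mkEmb B β β.strictMono _ (Sys.Copy.map hf β.strictMono hcopy)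
  have main : ∀ e : A.Emb B, χ (g.comp e) = col := by
    intro e
    rw [← hβ e.f e.mono]
    refine hc (β ∘ e.f) (β.strictMono.comp e.mono) (fun _ => β) ?_ _ ?_
    · intro u v w huv hvw
      rw [e.pres]
      exact hcopy _ _ _ (e.mono huv) (e.mono hvw)
    · show g.f ∘ e.f = _
      rw [hg]; rfl
  refine ⟨g, fun e e' => ?_⟩
  rw [main, main]
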